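/- arXiv:2003.03899 — 7 statements merged into one kernel-verified Lean document; each statement's English description precedes it below -/
import Mathlib

section
/- Let (A, d_A) be a differential algebra of weight λ and let (V, d_V) be a bimodule over (A, d_A). Define new actions x ⊢_λ v = (x + λ·d_A(x))·v and v ⊣_λ x = v·(x + λ·d_A(x)) for x ∈ A, v ∈ V. Then (V, ⊢_λ, ⊣_λ) is a bimodule over the associative algebra A (i.e. x ⊢_λ (y ⊢_λ v) = (xy) ⊢_λ v, (v ⊣_λ x) ⊣_λ y = v ⊣_λ (xy), and (x ⊢_λ v) ⊣_λ y = x ⊢_λ (v ⊣_λ y)), and moreover (V, ⊢_λ, ⊣_λ, d_V) is a bimodule over the differential algebra (A, d_A), i.e. d_V(x ⊢_λ v) = d_A(x) ⊢_λ v + x ⊢_λ d_V(v) + λ·d_A(x) ⊢_λ d_V(v) and d_V(v ⊣_λ x) = v ⊣_λ d_A(x) + d_V(v) ⊣_λ x + λ·d_V(v) ⊣_λ d_A(x). -/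
/-!
STATEMENT 0: Lemma 3.1 (le:bmd) of "Cohomologies, extensions and deformations of
differential algebras with any weights".

Given a differential algebra `(A, dA)` of weight `lam` and a bimodule `(V, l, r, dV)`
over it, the twisted actions `x ⊢ v = (x + lam • dA x) • v` and
`v ⊣ x = v • (x + lam • dA x)` again make `(V, dV)` a bimodule over the differential
algebra `(A, dA)`.
-/

theorem twisted_actions_form_differential_bimodule
    {k : Type*} [Field k] [CharZero k] (lam : k)
    {A : Type*} [NonUnitalRing A] [Module k A] [SMulCommClass k A A] [IsScalarTower k A A]
    {V : Type*} [AddCommGroup V] [Module k V]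
    (dA : A →ₗ[k] A)
    (hdA : ∀ x y : A, dA (x * y) = dA x * y + x * dA y + lam • (dA x * dA y))
    (l r : A →ₗ[k] V →ₗ[k] V)
    (hl : ∀ (x y : A) (v : V), l (x * y) v = l x (l y v))
    (hr : ∀ (x y : A) (v : V), r (x * y) v = r y (r x v))
    (hlr : ∀ (x y : A) (v : V), r y (l x v) = l x (r y v))
    (dV : V →ₗ[k] V)
    (hdVl : ∀ (x : A) (v : V),
      dV (l x v) = l (dA x) v + l x (dV v) + lam • l (dA x) (dV v))
    (hdVr : ∀ (x : A) (v : V),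
      dV (r x v) = r (dA x) v + r x (dV v) + lam • r (dA x) (dV v)) :
    -- (V, ⊢_lam, ⊣_lam) is a bimodule over the associative algebra A:
    (∀ (x y : A) (v : V),
      l (x + lam • dA x) (l (y + lam • dA y) v) = l (x * y + lam • dA (x * y)) v) ∧
    (∀ (x y : A) (v : V),
      r (y + lam • dA y) (r (x + lam • dA x) v) = r (x * y + lam • dA (x * y)) v) ∧
    (∀ (x y : A) (v : V),
      r (y + lam • dA y) (l (x + lam • dA x) v) = l (x + lam • dA x) (r (y + lam • dA y) v)) ∧
    -- (V, ⊢_lam, ⊣_lam, dV) is moreover a bimodule over the differential algebra (A, dA):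
    (∀ (x : A) (v : V),
      dV (l (x + lam • dA x) v)
        = l (dA x + lam • dA (dA x)) v + l (x + lam • dA x) (dV v)
            + lam • l (dA x + lam • dA (dA x)) (dV v)) ∧
    (∀ (x : A) (v : V),
      dV (r (x + lam • dA x) v)
        = r (dA x + lam • dA (dA x)) v + r (x + lam • dA x) (dV v)
            + lam • r (dA x + lam • dA (dA x)) (dV v)) := by
  have hmul (x y : A) :
      x * y + lam • dA (x * y) = (x + lam • dA x) * (y + lam • dA y) := by
    simp only [hdA, smul_add, add_mul, mul_add, smul_mul_assoc, mul_smul_comm]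
    abel
  have hd (x : A) : dA x + lam • dA (dA x) = dA (x + lam • dA x) := by
    rw [map_add, map_smul]
  refine ⟨fun x y v => ?_, fun x y v => ?_, fun x y v => hlr _ _ v,
    fun x v => ?_, fun x v => ?_⟩
  · rw [hmul, hl]
  · rw [hmul, hr]
  · rw [hd, hdVl]
  · rw [hd, hdVr]
end

section
/- Let (A, d_A) be a differential algebra of weight λ and (V, d_V) a bimodule over it. Then the map δ is a cochain map from the Hochschild cochain complex (C^*_alg(A,V), ∂) to the cochain complex (C^*_DO(d_A,d_V), ∂_λ); that is, ∂_λ(δv) = δ(∂v) for all v ∈ V, and ∂_λ(δf) = δ(∂f) for all n ≥ 1 and all f ∈ C^n_alg(A,V). -/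
/-!
STATEMENT 3: Proposition 3.4 (prop:delta) of the paper.

The map `δ` is a cochain map from the Hochschild cochain complex `(C^*_alg(A,V), ∂)`
to the cochain complex `(C^*_DO(dA,dV), ∂_lam)` of the differential operator.
-/

open Finset

/-- Apply `d` to the arguments whose index lies in `S`. -/
def dApp {A : Type*} {m : ℕ} (d : A → A) (S : Finset (Fin m)) (x : Fin m → A) :
    Fin m → A :=
  fun i => if i ∈ S then d (x i) else x i

/-- Merge the arguments in positions `j` and `j+1` (0-indexed) by multiplication. -/
def mulAt {A : Type*} [Mul A] {n : ℕ} (x : Fin (n + 1) → A) (j : Fin n) : Fin n → A :=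
  fun i =>
    if i.1 < j.1 then x i.castSucc
    else if i.1 = j.1 then x i.castSucc * x i.succ
    else x i.succ

/-- The Hochschild coboundary with respect to a left action `l` and right action `r`. -/
def hochF {k : Type*} [Field k]
    {A : Type*} [NonUnitalRing A] [Module k A]
    {V : Type*} [AddCommGroup V] [Module k V]
    (l r : A →ₗ[k] V →ₗ[k] V) (n : ℕ) (f : (Fin n → A) → V) :
    (Fin (n + 1) → A) → V :=
  fun x =>
    l (x 0) (f fun i => x i.succ)
      + (∑ j : Fin n, ((-1 : ℤ) ^ (j.1 + 1)) • f (mulAt x j))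
      + ((-1 : ℤ) ^ (n + 1)) • r (x (Fin.last n)) (f fun i => x i.castSucc)

/-- The map `δ : C^n_alg(A,V) → C^n_DO(dA,dV)`,
`δf(x₁,…,xₙ) = Σ_{k=1}^n λ^{k-1} Σ_{i₁<⋯<i_k} f(x₁,…,dA x_{i₁},…,dA x_{i_k},…,xₙ)
                 - dV (f (x₁,…,xₙ))`. -/
def deltaF {k : Type*} [Field k]
    {A : Type*} [NonUnitalRing A] [Module k A]
    {V : Type*} [AddCommGroup V] [Module k V]
    (lam : k) (dA : A → A) (dV : V → V) (n : ℕ) (f : (Fin n → A) → V) :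
    (Fin n → A) → V :=
  fun x =>
    (∑ S ∈ univ.filter fun S : Finset (Fin n) => S.Nonempty,
        lam ^ (S.card - 1) • f (dApp dA S x))
      - dV (f x)

/-- The sum of `lam ^ (|S| - 1) • F (dApp d S x)` over the nonempty sets `S` of positions. -/
def nonemptySum {k : Type*} [Field k] {A : Type*} {V : Type*} [AddCommGroup V] [Module k V]
    (lam : k) (d : A → A) {n : ℕ} (F : (Fin n → A) → V) (x : Fin n → A) : V :=
  ∑ S ∈ univ.filter fun S : Finset (Fin n) => S.Nonempty,
    lam ^ (S.card - 1) • F (dApp d S x)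

theorem dApp_empty {A : Type*} {n : ℕ} (d : A → A) (x : Fin n → A) : dApp d ∅ x = x := by
  funext i
  simp [dApp]

theorem dApp_map_succ {A : Type*} {n : ℕ} (d : A → A) (S : Finset (Fin n))
    (x : Fin (n + 1) → A) :
    dApp d (S.map (Fin.succEmb n)) x = Fin.cons (x 0) (dApp d S (Fin.tail x)) := by
  funext i
  cases i using Fin.cases <;> simp [dApp, Fin.tail]

theorem dApp_insert_zero_map_succ {A : Type*} {n : ℕ} (d : A → A) (S : Finset (Fin n))
    (x : Fin (n + 1) → A) :
    dApp d (insert 0 (S.map (Fin.succEmb n))) x =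
      Fin.cons (d (x 0)) (dApp d S (Fin.tail x)) := by
  funext i
  cases i using Fin.cases <;> simp [dApp, Fin.tail]

theorem sum_finset_fin_succ {M : Type*} [AddCommMonoid M] {n : ℕ}
    (g : Finset (Fin (n + 1)) → M) :
    ∑ S, g S = ∑ S : Finset (Fin n), g (S.map (Fin.succEmb n)) +
      ∑ S : Finset (Fin n), g (insert 0 (S.map (Fin.succEmb n))) := by
  have h (p : Finset (Fin (n + 1)) → M) :
      ∑ S ∈ (univ.map (Fin.succEmb n)).powerset, p S =
        ∑ S : Finset (Fin n), p (S.map (Fin.succEmb n)) := by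
    refine (sum_bij (fun S _ => S.map (Fin.succEmb n)) ?_ ?_ ?_ ?_).symm
    · intro S _
      exact mem_powerset.2 (map_subset_map.2 (subset_univ S))
    · intro S _ T _ hST
      exact map_injective _ hST
    · intro T hT
      obtain ⟨S, -, rfl⟩ := subset_map_iff.1 (mem_powerset.1 hT)
      exact ⟨S, mem_univ _, rfl⟩
    · intros
      rfl
  have hu : (univ : Finset (Fin (n + 1))) = insert 0 (univ.map (Fin.succEmb n)) := by
    rw [Fin.univ_succ, cons_eq_insert]
    rfl
  rw [← powerset_univ, hu, sum_powerset_insert (by simp), h, h]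

section NonemptySum

variable {k : Type*} [Field k] {A : Type*} {V : Type*} [AddCommGroup V] [Module k V]
  (lam : k) (d : A → A)

theorem nonemptySum_eq_sum_ite {n : ℕ} (F : (Fin n → A) → V) (x : Fin n → A) :
    nonemptySum lam d F x =
      ∑ S : Finset (Fin n), if S.Nonempty then lam ^ (S.card - 1) • F (dApp d S x) else 0 :=
  sum_filter _ _

theorem sum_pow_card_smul {n : ℕ} (F : (Fin n → A) → V) (x : Fin n → A) :
    ∑ S : Finset (Fin n), lam ^ S.card • F (dApp d S x) =
      F x + lam • nonemptySum lam d F x := by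
  rw [nonemptySum_eq_sum_ite, smul_sum,
    ← add_sum_erase univ _ (mem_univ (∅ : Finset (Fin n))),
    ← add_sum_erase univ (fun S => lam • ite _ _ _) (mem_univ (∅ : Finset (Fin n)))]
  simp only [dApp_empty, card_empty, pow_zero, one_smul, Finset.not_nonempty_empty, if_false,
    smul_zero, zero_add]
  congr 1
  refine sum_congr rfl fun S hS => ?_
  have hS' : S.Nonempty := nonempty_iff_ne_empty.2 (ne_of_mem_erase hS)
  rw [if_pos hS', smul_smul, mul_pow_sub_one hS'.card_ne_zero]

theorem nonemptySum_zero (F : (Fin 0 → A) → V) (x : Fin 0 → A) : nonemptySum lam d F x = 0 := by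
  refine sum_eq_zero fun S hS => ?_
  obtain ⟨i, -⟩ := (mem_filter.1 hS).2
  exact i.elim0

theorem nonemptySum_succ {n : ℕ} (F : (Fin (n + 1) → A) → V) (x : Fin (n + 1) → A) :
    nonemptySum lam d F x =
      nonemptySum lam d (fun y => F (Fin.cons (x 0) y)) (Fin.tail x) +
        (F (Fin.cons (d (x 0)) (Fin.tail x)) +
          lam • nonemptySum lam d (fun y => F (Fin.cons (d (x 0)) y)) (Fin.tail x)) := by
  rw [← sum_pow_card_smul lam d (fun y => F (Fin.cons (d (x 0)) y)), nonemptySum_eq_sum_ite, sum_finset_fin_succ, nonemptySum_eq_sum_ite]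
  congr 1
  · simp only [map_nonempty, card_map, dApp_map_succ]
  · refine sum_congr rfl fun S _ => ?_
    rw [if_pos (insert_nonempty _ _), card_insert_of_notMem (by simp), card_map,
      dApp_insert_zero_map_succ, Nat.add_sub_cancel]

theorem nonemptySum_add {n : ℕ} (F G : (Fin n → A) → V) (x : Fin n → A) :
    nonemptySum lam d (fun y => F y + G y) x =
      nonemptySum lam d F x + nonemptySum lam d G x := by
  simp only [nonemptySum, smul_add, sum_add_distrib]

theorem map_nonemptySum {W : Type*} [AddCommGroup W] [Module k W] (φ : V →ₗ[k] W) {n : ℕ}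
    (F : (Fin n → A) → V) (x : Fin n → A) :
    nonemptySum lam d (fun y => φ (F y)) x = φ (nonemptySum lam d F x) := by
  simp only [nonemptySum, map_sum, map_smul]

theorem nonemptySum_smul {n : ℕ} (c : k) (F : (Fin n → A) → V) (x : Fin n → A) :
    nonemptySum lam d (fun y => c • F y) x = c • nonemptySum lam d F x :=
  map_nonemptySum lam d (c • LinearMap.id) F x

theorem nonemptySum_zsmul {n : ℕ} (c : ℤ) (F : (Fin n → A) → V) (x : Fin n → A) :
    nonemptySum lam d (fun y => c • F y) x = c • nonemptySum lam d F x :=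
  map_nonemptySum lam d (c • LinearMap.id) F x

theorem nonemptySum_sum {ι : Type*} (s : Finset ι) {n : ℕ} (F : ι → (Fin n → A) → V)
    (x : Fin n → A) :
    nonemptySum lam d (fun y => ∑ j ∈ s, F j y) x = ∑ j ∈ s, nonemptySum lam d (F j) x := by
  simp only [nonemptySum, smul_sum]
  exact sum_comm

end NonemptySum

theorem mulAt_cons_cons_zero {A : Type*} [Mul A] {n : ℕ} (a b : A) (y : Fin n → A) :
    mulAt (Fin.cons a (Fin.cons b y : Fin (n + 1) → A) : Fin (n + 2) → A) 0 =
      Fin.cons (a * b) y := by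
  funext i
  cases i using Fin.cases with
  | zero => simp [mulAt]
  | succ i => simp [mulAt]

theorem mulAt_cons_succ {A : Type*} [Mul A] {n : ℕ} (a : A) (y : Fin (n + 1) → A) (j : Fin n) :
    mulAt (Fin.cons a y : Fin (n + 2) → A) j.succ = Fin.cons a (mulAt y j) := by
  funext i
  cases i using Fin.cases with
  | zero => simp [mulAt]
  | succ i => simp [mulAt]

section Hochschild

variable {k : Type*} [Field k] (lam : k)
  {A : Type*} [NonUnitalRing A] [Module k A]
  {V : Type*} [AddCommGroup V] [Module k V]
  (d : A →ₗ[k] A)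

theorem nonemptySum_left (l : A →ₗ[k] V →ₗ[k] V) {n : ℕ} (F : (Fin n → A) → V)
    (x : Fin (n + 1) → A) :
    nonemptySum lam d (fun y : Fin (n + 1) → A => l (y 0) (F fun i => y i.succ)) x =
      l (d (x 0)) (F fun i => x i.succ) +
        l (x 0 + lam • d (x 0)) (nonemptySum lam d F fun i => x i.succ) := by
  rw [nonemptySum_succ]
  simp only [Fin.cons_zero, Fin.cons_succ, map_nonemptySum, map_add, map_smul,
    LinearMap.add_apply, LinearMap.smul_apply]
  simp only [Fin.tail_def]
  abel

theorem nonemptySum_right (r : A →ₗ[k] V →ₗ[k] V) {n : ℕ} (F : (Fin n → A) → V)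
    (x : Fin (n + 1) → A) :
    nonemptySum lam d
        (fun y : Fin (n + 1) → A => r (y (Fin.last n)) (F fun i => y i.castSucc)) x =
      r (d (x (Fin.last n))) (F fun i => x i.castSucc) +
        r (x (Fin.last n) + lam • d (x (Fin.last n)))
          (nonemptySum lam d F fun i => x i.castSucc) := by
  induction n with
  | zero =>
    rw [nonemptySum_succ]
    simp only [nonemptySum_zero, smul_zero, add_zero, zero_add, map_zero]
    congr 2
    exact Subsingleton.elim _ _
  | succ n ih =>
    have init_cons (a : A) (y : Fin (n + 1) → A) :
        (fun i : Fin (n + 1) => (Fin.cons a y : Fin (n + 2) → A) i.castSucc) =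
          Fin.cons a fun i => y i.castSucc := by
      funext i
      cases i using Fin.cases <;> simp
    obtain ⟨a, x, rfl⟩ : ∃ a y, x = Fin.cons a y := ⟨_, _, (Fin.cons_self_tail x).symm⟩
    rw [nonemptySum_succ]
    simp only [init_cons, ← Fin.succ_last, Fin.cons_succ, Fin.cons_zero, Fin.tail_cons]
    rw [ih fun y => F (Fin.cons a y), ih fun y => F (Fin.cons (d a) y),
      nonemptySum_succ lam d F]
    simp only [Fin.cons_zero, Fin.tail_cons, map_add, map_smul, LinearMap.add_apply,
      LinearMap.smul_apply]
    module

theorem nonemptySum_mulAt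
    (hd : ∀ x y : A, d (x * y) = d x * y + x * d y + lam • (d x * d y))
    {n : ℕ} (f : MultilinearMap k (fun _ : Fin n => A) V) (j : Fin n) (x : Fin (n + 1) → A) :
    nonemptySum lam d (fun y => f (mulAt y j)) x = nonemptySum lam d f (mulAt x j) := by
  induction n with
  | zero => exact j.elim0
  | succ n ih =>
    obtain ⟨a, x, rfl⟩ : ∃ a y, x = Fin.cons a y := ⟨_, _, (Fin.cons_self_tail x).symm⟩
    cases j using Fin.cases with
    | zero =>
      obtain ⟨b, x, rfl⟩ : ∃ b y, x = Fin.cons b y := ⟨_, _, (Fin.cons_self_tail x).symm⟩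
      rw [nonemptySum_succ, nonemptySum_succ, nonemptySum_succ (n := n),
        nonemptySum_succ lam d f]
      simp only [mulAt_cons_cons_zero, Fin.cons_zero, Fin.tail_cons, hd,
        MultilinearMap.cons_add, MultilinearMap.cons_smul, nonemptySum_add, nonemptySum_smul]
      module
    | succ j =>
      rw [nonemptySum_succ, nonemptySum_succ lam d f]
      simp only [mulAt_cons_succ, Fin.cons_zero, Fin.tail_cons]
      have h (c : A) := ih (f.curryLeft c) j x
      simp only [MultilinearMap.curryLeft_apply] at h
      rw [h, h]
      rfl

theorem hochF_deltaF
    (hd : ∀ x y : A, d (x * y) = d x * y + x * d y + lam • (d x * d y))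
    (l r : A →ₗ[k] V →ₗ[k] V) (dV : V →ₗ[k] V)
    (hdVl : ∀ (x : A) (v : V),
      dV (l x v) = l (d x) v + l x (dV v) + lam • l (d x) (dV v))
    (hdVr : ∀ (x : A) (v : V),
      dV (r x v) = r (d x) v + r x (dV v) + lam • r (d x) (dV v))
    {n : ℕ} (f : MultilinearMap k (fun _ : Fin n => A) V) :
    hochF (l.comp (LinearMap.id + lam • d)) (r.comp (LinearMap.id + lam • d)) n
        (deltaF lam d dV n f) =
      deltaF lam d dV (n + 1) (hochF l r n f) := by
  have deltaF_apply {m : ℕ} (F : (Fin m → A) → V) (x : Fin m → A) :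
      deltaF lam d dV m F x = nonemptySum lam d F x - dV (F x) := rfl
  funext x
  rw [deltaF_apply]
  unfold hochF
  simp only [deltaF_apply, nonemptySum_add, nonemptySum_sum, nonemptySum_zsmul,
    nonemptySum_left, nonemptySum_right, nonemptySum_mulAt lam d hd, map_add, map_sum, map_zsmul,
    hdVl, hdVr, smul_sub, sum_sub_distrib, LinearMap.comp_apply, LinearMap.add_apply,
    LinearMap.id_apply, LinearMap.smul_apply, map_sub, map_smul]
  module

end Hochschild

theorem delta_is_cochain_map
    {k : Type*} [Field k] [CharZero k] (lam : k)
    {A : Type*} [NonUnitalRing A] [Module k A] [SMulCommClass k A A] [IsScalarTower k A A]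
    {V : Type*} [AddCommGroup V] [Module k V]
    (dA : A →ₗ[k] A)
    (hdA : ∀ x y : A, dA (x * y) = dA x * y + x * dA y + lam • (dA x * dA y))
    (l r : A →ₗ[k] V →ₗ[k] V)
    (hl : ∀ (x y : A) (v : V), l (x * y) v = l x (l y v))
    (hr : ∀ (x y : A) (v : V), r (x * y) v = r y (r x v))
    (hlr : ∀ (x y : A) (v : V), r y (l x v) = l x (r y v))
    (dV : V →ₗ[k] V)
    (hdVl : ∀ (x : A) (v : V),
      dV (l x v) = l (dA x) v + l x (dV v) + lam • l (dA x) (dV v))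
    (hdVr : ∀ (x : A) (v : V),
      dV (r x v) = r (dA x) v + r x (dV v) + lam • r (dA x) (dV v)) :
    -- ∂_lam (δ v) = δ (∂ v) for all v ∈ V = C^0_alg(A, V)
    (∀ v : V,
      hochF (l.comp (LinearMap.id + lam • dA)) (r.comp (LinearMap.id + lam • dA)) 0
          (deltaF lam dA dV 0 fun _ => v)
        = deltaF lam dA dV 1 (hochF l r 0 fun _ => v)) ∧
    -- ∂_lam (δ f) = δ (∂ f) for all n and all multilinear f ∈ C^n_alg(A, V)
    (∀ (n : ℕ) (f : MultilinearMap k (fun _ : Fin n => A) V),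
      hochF (l.comp (LinearMap.id + lam • dA)) (r.comp (LinearMap.id + lam • dA)) n
          (deltaF lam dA dV n ⇑f)
        = deltaF lam dA dV (n + 1) (hochF l r n ⇑f)) := by
  have main {n : ℕ} (f : MultilinearMap k (fun _ : Fin n => A) V) :=
    hochF_deltaF lam dA hdA l r dV hdVl hdVr f
  exact ⟨fun v => main (MultilinearMap.constOfIsEmpty k (fun _ : Fin 0 => A) v),
    fun _ f => main f⟩
end

section
/- Let (A, d_A) be a differential algebra of weight λ, (V, d_V) a bimodule over it, and let ψ : A ⊗ A → V and χ : A → V be linear maps. Equip A ⊕ V with the multiplication (x, u) ·_ψ (y, v) = (xy, x·v + u·y + ψ(x, y)) and the operator d_χ(x, v) = (d_A(x), χ(x) + d_V(v)). Then (A ⊕ V, ·_ψ, d_χ) is a differential algebra of weight λ if and only if (ψ, χ) is a 2-cocycle, i.e. for all x, y, z ∈ A: x·ψ(y, z) − ψ(xy, z) + ψ(x, yz) − ψ(x, y)·z = 0 and χ(xy) − x ⊢_λ χ(y) − χ(x) ⊣_λ y + d_V(ψ(x, y)) − ψ(d_A(x), y) − ψ(x, d_A(y)) − λ·ψ(d_A(x),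 d_A(y)) = 0. -/
/-!
STATEMENT 8: Proposition 4.5 (prop:2-cocycle) of the paper.

Given linear maps `ψ : A ⊗ A → V` and `χ : A → V`, the space `A ⊕ V` with the
multiplication `(x,u) ·_ψ (y,v) = (xy, x·v + u·y + ψ(x,y))` and the operator
`d_χ(x,v) = (dA x, χ x + dV v)` is a differential algebra of weight `lam` if and
only if `(ψ, χ)` is a 2-cocycle.
-/

/-- The multiplication `·_ψ` on `A × V`. -/
def psiMul {k : Type*} [Field k]
    {A : Type*} [NonUnitalRing A] [Module k A]
    {V : Type*} [AddCommGroup V] [Module k V]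
    (l r : A →ₗ[k] V →ₗ[k] V) (ψ : A →ₗ[k] A →ₗ[k] V) (p q : A × V) : A × V :=
  (p.1 * q.1, l p.1 q.2 + r q.1 p.2 + ψ p.1 q.1)

/-- The operator `d_χ` on `A × V`. -/
def chiD {k : Type*} [Field k]
    {A : Type*} [NonUnitalRing A] [Module k A]
    {V : Type*} [AddCommGroup V] [Module k V]
    (dA : A →ₗ[k] A) (dV : V →ₗ[k] V) (χ : A →ₗ[k] V) (p : A × V) : A × V :=
  (dA p.1, χ p.1 + dV p.2)

theorem extension_is_differential_algebra_iff_two_cocycle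
    {k : Type*} [Field k] [CharZero k] (lam : k)
    {A : Type*} [NonUnitalRing A] [Module k A] [SMulCommClass k A A] [IsScalarTower k A A]
    {V : Type*} [AddCommGroup V] [Module k V]
    (dA : A →ₗ[k] A)
    (hdA : ∀ x y : A, dA (x * y) = dA x * y + x * dA y + lam • (dA x * dA y))
    (l r : A →ₗ[k] V →ₗ[k] V)
    (hl : ∀ (x y : A) (v : V), l (x * y) v = l x (l y v))
    (hr : ∀ (x y : A) (v : V), r (x * y) v = r y (r x v))
    (hlr : ∀ (x y : A) (v : V), r y (l x v) = l x (r y v))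
    (dV : V →ₗ[k] V)
    (hdVl : ∀ (x : A) (v : V),
      dV (l x v) = l (dA x) v + l x (dV v) + lam • l (dA x) (dV v))
    (hdVr : ∀ (x : A) (v : V),
      dV (r x v) = r (dA x) v + r x (dV v) + lam • r (dA x) (dV v))
    (ψ : A →ₗ[k] A →ₗ[k] V) (χ : A →ₗ[k] V) :
    -- (A ⊕ V, ·_ψ, d_χ) is a differential algebra of weight lam
    ((∀ p q s : A × V,
        psiMul l r ψ (psiMul l r ψ p q) s = psiMul l r ψ p (psiMul l r ψ q s)) ∧
      (∀ p q : A × V,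
        chiD dA dV χ (psiMul l r ψ p q)
          = psiMul l r ψ (chiD dA dV χ p) q + psiMul l r ψ p (chiD dA dV χ q)
              + lam • psiMul l r ψ (chiD dA dV χ p) (chiD dA dV χ q)))
    ↔
    -- (ψ, χ) is a 2-cocycle
    ((∀ x y z : A,
        l x (ψ y z) - ψ (x * y) z + ψ x (y * z) - r z (ψ x y) = 0) ∧
      (∀ x y : A,
        χ (x * y) - l (x + lam • dA x) (χ y) - r (y + lam • dA y) (χ x)
            + dV (ψ x y) - ψ (dA x) y - ψ x (dA y) - lam • ψ (dA x) (dA y) = 0)) := by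
  refine and_congr ⟨fun h x y z => ?_, fun h p q s => ?_⟩ ⟨fun h x y => ?_, fun h p q => ?_⟩
  · have e := congrArg Prod.snd (h (x, 0) (y, 0) (z, 0))
    simp only [psiMul, map_zero, add_zero, zero_add] at e
    linear_combination (norm := module) -e
  · refine Prod.ext (mul_assoc _ _ _) ?_
    simp only [psiMul, map_add, hl, hr, hlr]
    linear_combination (norm := module) -h p.1 q.1 s.1
  · have e := congrArg Prod.snd (h (x, 0) (y, 0))
    simp only [psiMul, chiD, map_zero, add_zero, zero_add, Prod.snd_add, Prod.smul_snd] at e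
    simp only [map_add, map_smul, LinearMap.add_apply, LinearMap.smul_apply]
    linear_combination (norm := module) e
  · refine Prod.ext (hdA _ _) ?_
    have e := h p.1 q.1
    simp only [map_add, map_smul, LinearMap.add_apply, LinearMap.smul_apply] at e
    simp only [psiMul, chiD, map_add, hdVl, hdVr, Prod.snd_add, Prod.smul_snd]
    linear_combination (norm := module) e
end

section
/- Let 0 → V →^i Â →^p A → 0 be an abelian extension of differential algebras of weight λ and let s_1, s_2 : A → Â be two sections of p. For j = 1, 2 define ψ_j(x, y) = s_j(x)s_j(y) − s_j(xy) and χ_j(x) = d_Â(s_j(x)) − s_j(d_A(x)), and set φ = s_1 − s_2 (which takes values in V). Then for all x, y ∈ A: ψ_1(x, y) = ψ_2(x, y) + x·φ(y) + φ(x)·y − φ(xy) and χ_1(x) = χ_2(x) + d_V(φ(x)) − φ(d_A(x)); i.e. the two 2-cocycles differ by the coboundary ∂_Diff(φ). -/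
/-!
STATEMENT 9: (part of the proof of Theorem 4.6 of the paper)

Two sections `s₁, s₂` of an abelian extension of differential algebras give rise to
2-cocycles `(ψ₁, χ₁)`, `(ψ₂, χ₂)` that differ by the coboundary of `φ = s₁ - s₂`.
-/

theorem two_sections_give_cohomologous_cocycles
    {k : Type*} [Field k] [CharZero k] (lam : k)
    -- the differential algebra (A, dA)
    {A : Type*} [NonUnitalRing A] [Module k A] [SMulCommClass k A A] [IsScalarTower k A A]
    (dA : A →ₗ[k] A)
    (hdA : ∀ x y : A, dA (x * y) = dA x * y + x * dA y + lam • (dA x * dA y))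
    -- the differential algebra (Â, dAh)
    {Ahat : Type*} [NonUnitalRing Ahat] [Module k Ahat]
    [SMulCommClass k Ahat Ahat] [IsScalarTower k Ahat Ahat]
    (dAh : Ahat →ₗ[k] Ahat)
    (hdAh : ∀ x y : Ahat, dAh (x * y) = dAh x * y + x * dAh y + lam • (dAh x * dAh y))
    -- (V, dV)
    {V : Type*} [AddCommGroup V] [Module k V] (dV : V →ₗ[k] V)
    -- the abelian extension 0 → V →(i) Â →(p) A → 0
    (i : V →ₗ[k] Ahat) (hi : Function.Injective i)
    (hid : ∀ v : V, i (dV v) = dAh (i v))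
    (p : Ahat →ₙₐ[k] A) (hp : Function.Surjective p)
    (hpd : ∀ w : Ahat, p (dAh w) = dA (p w))
    (hexact : ∀ w : Ahat, p w = 0 ↔ w ∈ Set.range i)
    (habelian : ∀ u v : V, i u * i v = 0)
    -- two sections of p
    (s₁ s₂ : A →ₗ[k] Ahat) (hs₁ : ∀ x : A, p (s₁ x) = x) (hs₂ : ∀ x : A, p (s₂ x) = x)
    -- the induced A-bimodule structure on V
    (l r : A → V → V)
    (hl : ∀ (x : A) (v : V), i (l x v) = s₁ x * i v)
    (hr : ∀ (x : A) (v : V), i (r x v) = i v * s₁ x)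
    -- φ = s₁ - s₂, taking values in V
    (φ : A →ₗ[k] V) (hφ : ∀ x : A, i (φ x) = s₁ x - s₂ x)
    -- the two associated 2-cocycles
    (ψ₁ ψ₂ : A → A → V) (χ₁ χ₂ : A → V)
    (hψ₁ : ∀ x y : A, i (ψ₁ x y) = s₁ x * s₁ y - s₁ (x * y))
    (hψ₂ : ∀ x y : A, i (ψ₂ x y) = s₂ x * s₂ y - s₂ (x * y))
    (hχ₁ : ∀ x : A, i (χ₁ x) = dAh (s₁ x) - s₁ (dA x))
    (hχ₂ : ∀ x : A, i (χ₂ x) = dAh (s₂ x) - s₂ (dA x)) :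
    -- the cocycles differ by the coboundary ∂_Diff(φ)
    (∀ x y : A, ψ₁ x y = ψ₂ x y + l x (φ y) + r y (φ x) - φ (x * y)) ∧
    (∀ x : A, χ₁ x = χ₂ x + dV (φ x) - φ (dA x)) := by
  refine ⟨fun x y => hi ?_, fun x => hi ?_⟩
  · have hzero := habelian (φ x) (φ y)
    simp only [hφ, sub_mul, mul_sub] at hzero
    simp only [map_sub, map_add, hψ₁, hψ₂, hl, hr, hφ, sub_mul, mul_sub]
    rw [← sub_eq_zero, ← neg_eq_zero, ← hzero]
    abel
  · simp only [map_sub, map_add, hχ₁, hχ₂, hid, hφ]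
    abel
end

section
/- Let (μ_t, d_t) be a 1-parameter formal deformation of a differential algebra (A, d_A) of weight λ, with μ_t = Σ_{i≥0} μ_i t^i and d_t = Σ_{i≥0} d_i t^i. Then the infinitesimal (μ_1, d_1) is a 2-cocycle of (A, d_A) with coefficients in the regular bimodule (A, d_A); explicitly, for all x, y, z ∈ A: x·μ_1(y, z) − μ_1(xy, z) + μ_1(x, yz) − μ_1(x, y)·z = 0, and x ⊢_λ d_1(y) − d_1(xy) + d_1(x) ⊣_λ y + μ_1(d_A(x), y) + μ_1(x, d_A(y)) + λ·μ_1(d_A(x), d_A(y)) − d_A(μ_1(x, y)) = 0 (i.e. ∂μ_1 = 0 and ∂_λ d_1 + δμ_1 = 0). -/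
/-!
STATEMENT 13: Proposition 6.4 (prop:fddco) of the paper.

The infinitesimal `(μ₁, d₁)` of a 1-parameter formal deformation `(μ_t, d_t)` of a
differential algebra `(A, dA)` of weight `lam` is a 2-cocycle of `(A, dA)` with
coefficients in the regular bimodule.
-/

open Finset

theorem infinitesimal_of_deformation_is_two_cocycle
    {k : Type*} [Field k] [CharZero k] (lam : k)
    {A : Type*} [NonUnitalRing A] [Module k A] [SMulCommClass k A A] [IsScalarTower k A A]
    (dA : A →ₗ[k] A)
    (hdA : ∀ x y : A, dA (x * y) = dA x * y + x * dA y + lam • (dA x * dA y))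
    -- a 1-parameter formal deformation (μ_t, d_t)
    (μ : ℕ → A →ₗ[k] A →ₗ[k] A) (d : ℕ → A →ₗ[k] A)
    (hμ₀ : ∀ x y : A, μ 0 x y = x * y)
    (hd₀ : d 0 = dA)
    (hassoc : ∀ (n : ℕ) (x y z : A),
      ∑ i ∈ range (n + 1), μ i (μ (n - i) x y) z
        = ∑ i ∈ range (n + 1), μ i x (μ (n - i) y z))
    (hleib : ∀ (n : ℕ) (x y : A),
      ∑ p ∈ antidiagonal n, d p.2 (μ p.1 x y)
        = ∑ p ∈ antidiagonal n, (μ p.1 (d p.2 x) y + μ p.1 x (d p.2 y))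
          + lam • ∑ p ∈ antidiagonal n, ∑ q ∈ antidiagonal p.2, μ p.1 (d q.1 x) (d q.2 y)) :
    -- (μ₁, d₁) is a 2-cocycle:  ∂ μ₁ = 0  and  ∂_lam d₁ + δ μ₁ = 0
    (∀ x y z : A,
      x * μ 1 y z - μ 1 (x * y) z + μ 1 x (y * z) - μ 1 x y * z = 0) ∧
    (∀ x y : A,
      (x + lam • dA x) * d 1 y - d 1 (x * y) + d 1 x * (y + lam • dA y)
        + μ 1 (dA x) y + μ 1 x (dA y) + lam • μ 1 (dA x) (dA y) - dA (μ 1 x y) = 0) := by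
  refine ⟨fun x y z => ?_, fun x y => ?_⟩
  · have h := hassoc 1 x y z
    simp only [sum_range_succ, range_zero, sum_empty, zero_add, Nat.sub_zero, Nat.sub_self,
      hμ₀] at h
    rw [sub_eq_zero, sub_add_eq_add_sub, sub_eq_iff_eq_add, ← h, add_comm]
  · have h := hleib 1 x y
    simp only [Nat.antidiagonal_succ, Nat.antidiagonal_zero, map_singleton, sum_cons,
      sum_singleton, Function.Embedding.prodMap, Function.Embedding.coeFn_mk, Prod.map,
      Function.Embedding.refl_apply, Nat.succ_eq_add_one, zero_add, hμ₀, hd₀, smul_add] at h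
    rw [← eq_sub_iff_add_eq] at h
    rw [h, add_mul, mul_add, smul_mul_assoc, mul_smul_comm]
    abel
end

section
/- Let (μ_t, d_t) and (μ̄_t, d̄_t) be two equivalent 1-parameter formal deformations of a differential algebra (A, d_A) of weight λ, with a formal isomorphism Φ_t = Σ_{i≥0} φ_i t^i (φ_0 = Id_A) from (μ̄_t, d̄_t) to (μ_t, d_t). Then their infinitesimals are cohomologous: for all x, y ∈ A, μ̄_1(x, y) = μ_1(x, y) + φ_1(x)·y + x·φ_1(y) − φ_1(xy) and d̄_1(x) = d_1(x) + d_A(φ_1(x)) − φ_1(d_A(x)); that is, (μ̄_1, d̄_1) = (μ_1, d_1) + ∂_Diff(φ_1). -/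
/-!
STATEMENT 15: Theorem 6.9 of the paper.

The infinitesimals of two equivalent 1-parameter formal deformations of a differential
algebra `(A, dA)` of weight `lam` differ by the coboundary `∂_Diff(φ₁)`; in particular
they are in the same cohomology class.
-/

open Finset

theorem infinitesimals_of_equivalent_deformations_are_cohomologous
    {k : Type*} [Field k] [CharZero k] (lam : k)
    {A : Type*} [NonUnitalRing A] [Module k A] [SMulCommClass k A A] [IsScalarTower k A A]
    (dA : A →ₗ[k] A)
    (hdA : ∀ x y : A, dA (x * y) = dA x * y + x * dA y + lam • (dA x * dA y))
    -- a 1-parameter formal deformation (μ_t, d_t)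
    (μ : ℕ → A →ₗ[k] A →ₗ[k] A) (d : ℕ → A →ₗ[k] A)
    (hμ₀ : ∀ x y : A, μ 0 x y = x * y)
    (hd₀ : d 0 = dA)
    (hassoc : ∀ (n : ℕ) (x y z : A),
      ∑ i ∈ range (n + 1), μ i (μ (n - i) x y) z
        = ∑ i ∈ range (n + 1), μ i x (μ (n - i) y z))
    (hleib : ∀ (n : ℕ) (x y : A),
      ∑ p ∈ antidiagonal n, d p.2 (μ p.1 x y)
        = ∑ p ∈ antidiagonal n, (μ p.1 (d p.2 x) y + μ p.1 x (d p.2 y))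
          + lam • ∑ p ∈ antidiagonal n, ∑ q ∈ antidiagonal p.2, μ p.1 (d q.1 x) (d q.2 y))
    -- a second 1-parameter formal deformation (μ̄_t, d̄_t)
    (μ' : ℕ → A →ₗ[k] A →ₗ[k] A) (d' : ℕ → A →ₗ[k] A)
    (hμ'₀ : ∀ x y : A, μ' 0 x y = x * y)
    (hd'₀ : d' 0 = dA)
    (hassoc' : ∀ (n : ℕ) (x y z : A),
      ∑ i ∈ range (n + 1), μ' i (μ' (n - i) x y) z
        = ∑ i ∈ range (n + 1), μ' i x (μ' (n - i) y z))
    (hleib' : ∀ (n : ℕ) (x y : A),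
      ∑ p ∈ antidiagonal n, d' p.2 (μ' p.1 x y)
        = ∑ p ∈ antidiagonal n, (μ' p.1 (d' p.2 x) y + μ' p.1 x (d' p.2 y))
          + lam • ∑ p ∈ antidiagonal n, ∑ q ∈ antidiagonal p.2, μ' p.1 (d' q.1 x) (d' q.2 y))
    -- a formal isomorphism Φ_t = Σ φᵢ tⁱ from (μ̄_t, d̄_t) to (μ_t, d_t)
    (φ : ℕ → A →ₗ[k] A)
    (hφ₀ : φ 0 = LinearMap.id)
    (hΦμ : ∀ (n : ℕ) (x y : A),
      ∑ p ∈ antidiagonal n, φ p.1 (μ' p.2 x y)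
        = ∑ p ∈ antidiagonal n, ∑ q ∈ antidiagonal p.2, μ p.1 (φ q.1 x) (φ q.2 y))
    (hΦd : ∀ (n : ℕ) (x : A),
      ∑ p ∈ antidiagonal n, φ p.1 (d' p.2 x) = ∑ p ∈ antidiagonal n, d p.1 (φ p.2 x)) :
    -- the infinitesimals differ by the coboundary ∂_Diff(φ₁)
    (∀ x y : A, μ' 1 x y = μ 1 x y + φ 1 x * y + x * φ 1 y - φ 1 (x * y)) ∧
    (∀ x : A, d' 1 x = d 1 x + dA (φ 1 x) - φ 1 (dA x)) := by
  constructor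
  · intro x y
    have h := hΦμ 1 x y
    simp only [Nat.antidiagonal_succ, Nat.antidiagonal_zero, map_singleton, sum_cons,
      sum_singleton, Function.Embedding.prodMap, Function.Embedding.coeFn_mk, Prod.map_apply,
      Function.Embedding.refl_apply, Nat.succ_eq_add_one, zero_add, hφ₀, hμ₀, hμ'₀,
      LinearMap.id_apply] at h
    rw [eq_sub_iff_add_eq, h]
    abel
  · intro x
    have h := hΦd 1 x
    simp only [Nat.antidiagonal_succ, Nat.antidiagonal_zero, map_singleton, sum_cons,
      sum_singleton, Function.Embedding.prodMap, Function.Embedding.coeFn_mk, Prod.map_apply,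
      Function.Embedding.refl_apply, Nat.succ_eq_add_one, zero_add, hφ₀, hd₀, hd'₀,
      LinearMap.id_apply] at h
    rw [eq_sub_iff_add_eq, h]
    abel
end

section
/- Let (A, d_A) be a differential algebra of weight λ, regarded as the regular bimodule over itself. If H̃²_Diff(A, A) = 0 — that is, every pair (f, g) of a bilinear map f : A ⊗ A → A and a linear map g : A → A with ∂f = 0 and ∂_λ g + δf = 0 is of the form (∂φ, x ↦ d_A(φ(x)) − φ(d_A(x))) for some linear map φ : A → A — then (A, d_A) is rigid: every 1-parameter formal deformation of (A, d_A) is equivalent to the trivial deformation (μ_A, d_A). -/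
open Finset

namespace FormalSeries

variable {k A B C : Type*} [Field k] [AddCommGroup A] [Module k A] [AddCommGroup B] [Module k B]
  [AddCommGroup C] [Module k C]

/-- The constant formal series with value `x`. -/
def const (x : A) : ℕ → A := Pi.single 0 x

/-- Multiplication of a formal series by the formal variable. -/
def shift (u : ℕ → A) : ℕ → A
  | 0 => 0
  | n + 1 => u n

/-- The Cauchy product of two formal series along a bilinear map. -/
def conv (b : A →ₗ[k] B →ₗ[k] C) (u : ℕ → A) (v : ℕ → B) (n : ℕ) : C :=
  ∑ p ∈ antidiagonal n, b (u p.1) (v p.2)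

/-- The extension of a formal series of linear maps to formal series. -/
def ext₁ (φ : ℕ → A →ₗ[k] B) (u : ℕ → A) (n : ℕ) : B :=
  ∑ p ∈ antidiagonal n, φ p.1 (u p.2)

/-- The extension of a formal series of bilinear maps to formal series. -/
def ext₂ (μ : ℕ → A →ₗ[k] B →ₗ[k] C) (u : ℕ → A) (v : ℕ → B) (n : ℕ) : C :=
  ∑ p ∈ antidiagonal n, conv (μ p.1) u v p.2

lemma sum_antidiagonal_const (f : ℕ → A → C) (hf : ∀ i, f i 0 = 0) (x : A) (n : ℕ) :
    ∑ p ∈ antidiagonal n, f p.1 (const x p.2) = f n x := by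
  rw [sum_eq_single (n, 0)]
  · simp [const]
  · rintro ⟨i, j⟩ hp hne
    have hj : j ≠ 0 := by
      rintro rfl
      simp_all
    simp [const, hj, hf]
  · simp

lemma sum_antidiagonal_shift (f : ℕ → A → C) (hf : ∀ i, f i 0 = 0) (u : ℕ → A) :
    (fun n => ∑ p ∈ antidiagonal n, f p.1 (shift u p.2)) =
      shift fun n => ∑ p ∈ antidiagonal n, f p.1 (u p.2) := by
  funext n
  cases n with
  | zero => simp [shift, hf]
  | succ n => simp [Nat.sum_antidiagonal_succ', shift, hf]

lemma eq_const_add_shift (u : ℕ → A) : u = const (u 0) + shift fun n => u (n + 1) := by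
  funext n
  cases n <;> simp [const, shift]

lemma shift_sub (u v : ℕ → A) : shift (u - v) = shift u - shift v := by
  funext n
  cases n <;> simp [shift]

lemma map_shift (f : A →ₗ[k] B) (u : ℕ → A) :
    (fun n => f (shift u n)) = shift fun n => f (u n) := by
  funext n
  cases n <;> simp [shift]

/-- An additive map commuting with `shift` and killing the coefficients of order below `n` on
constants kills them on all series, and its coefficient of order `n` depends only on the constant
term. -/
lemma coeff_eq_of_coeff_const_eq_zero {T : (ℕ → A) → ℕ → B}
    (hadd : ∀ u v, T (u + v) = T u + T v) (hshift : ∀ u, T (shift u) = shift (T u)) {n : ℕ}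
    (hT : ∀ m < n, ∀ x, T (const x) m = 0) (u : ℕ → A) :
    (∀ m < n, T u m = 0) ∧ T u n = T (const (u 0)) n := by
  have hsplit (u : ℕ → A) (m : ℕ) :
      T u m = T (const (u 0)) m + shift (T fun i => u (i + 1)) m := by
    conv_lhs => rw [eq_const_add_shift u]
    rw [hadd, hshift, Pi.add_apply]
  have hlow : ∀ m < n, ∀ u, T u m = 0 := by
    intro m
    induction m with
    | zero => intro hm u; rw [hsplit, hT 0 hm]; simp [shift]
    | succ m ih =>
      intro hm u
      rw [hsplit, hT _ hm]
      simpa [shift] using ih (by omega) _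
  refine ⟨fun m hm => hlow m hm u, ?_⟩
  rw [hsplit]
  cases n with
  | zero => simp [shift]
  | succ n => simpa [shift] using hlow n (by omega) _

lemma conv_add_left (b : A →ₗ[k] B →ₗ[k] C) (u u' : ℕ → A) (v : ℕ → B) :
    conv b (u + u') v = conv b u v + conv b u' v := by
  funext n
  simp [conv, sum_add_distrib]

lemma conv_flip (b : A →ₗ[k] B →ₗ[k] C) (u : ℕ → A) (v : ℕ → B) :
    conv b.flip v u = conv b u v := by
  funext n
  unfold conv
  rw [← Nat.sum_antidiagonal_swap]
  rfl

lemma conv_add_right (b : A →ₗ[k] B →ₗ[k] C) (u : ℕ → A) (v v' : ℕ → B) :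
    conv b u (v + v') = conv b u v + conv b u v' := by
  funext n
  simp [conv, sum_add_distrib]

lemma conv_shift_right (b : A →ₗ[k] B →ₗ[k] C) (u : ℕ → A) (v : ℕ → B) :
    conv b u (shift v) = shift (conv b u v) :=
  sum_antidiagonal_shift (fun i => b (u i)) (by simp) v

lemma conv_shift_left (b : A →ₗ[k] B →ₗ[k] C) (u : ℕ → A) (v : ℕ → B) :
    conv b (shift u) v = shift (conv b u v) := by
  rw [← conv_flip, conv_shift_right, conv_flip]

lemma conv_const_right (b : A →ₗ[k] B →ₗ[k] C) (u : ℕ → A) (y : B) (n : ℕ) :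
    conv b u (const y) n = b (u n) y :=
  sum_antidiagonal_const (fun i => b (u i)) (by simp) y n

lemma conv_const_left (b : A →ₗ[k] B →ₗ[k] C) (x : A) (v : ℕ → B) (n : ℕ) :
    conv b (const x) v n = b x (v n) := by
  rw [← conv_flip, conv_const_right]
  rfl

lemma conv_coeff_of_right_eq_zero (b : A →ₗ[k] B →ₗ[k] C) (u : ℕ → A) {v : ℕ → B} {n : ℕ}
    (hv : ∀ m < n, v m = 0) : conv b u v n = b (u 0) (v n) := by
  unfold conv
  rw [sum_eq_single (0, n)]
  · rintro ⟨i, j⟩ hp hne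
    rw [HasAntidiagonal.mem_antidiagonal] at hp
    have hj : j < n := by
      refine lt_of_le_of_ne (by simp at hp; omega) ?_
      rintro rfl
      simp_all
    simp [hv j hj]
  · simp

lemma conv_coeff_of_left_eq_zero (b : A →ₗ[k] B →ₗ[k] C) {u : ℕ → A} (v : ℕ → B) {n : ℕ}
    (hu : ∀ m < n, u m = 0) : conv b u v n = b (u n) (v 0) := by
  rw [← conv_flip, conv_coeff_of_right_eq_zero _ _ hu]
  rfl

lemma ext₁_add (φ : ℕ → A →ₗ[k] B) (u v : ℕ → A) :
    ext₁ φ (u + v) = ext₁ φ u + ext₁ φ v := by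
  funext n
  simp [ext₁, sum_add_distrib]

lemma ext₁_smul (φ : ℕ → A →ₗ[k] B) (c : k) (u : ℕ → A) :
    ext₁ φ (c • u) = c • ext₁ φ u := by
  funext n
  simp [ext₁, smul_sum]

lemma ext₁_shift (φ : ℕ → A →ₗ[k] B) (u : ℕ → A) : ext₁ φ (shift u) = shift (ext₁ φ u) :=
  sum_antidiagonal_shift (fun i => φ i) (by simp) u

lemma ext₁_const (φ : ℕ → A →ₗ[k] B) (x : A) (n : ℕ) : ext₁ φ (const x) n = φ n x :=
  sum_antidiagonal_const (fun i => φ i) (by simp) x n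

lemma ext₂_add_left (μ : ℕ → A →ₗ[k] B →ₗ[k] C) (u u' : ℕ → A) (v : ℕ → B) :
    ext₂ μ (u + u') v = ext₂ μ u v + ext₂ μ u' v := by
  funext n
  simp [ext₂, conv_add_left, sum_add_distrib]

lemma ext₂_add_right (μ : ℕ → A →ₗ[k] B →ₗ[k] C) (u : ℕ → A) (v v' : ℕ → B) :
    ext₂ μ u (v + v') = ext₂ μ u v + ext₂ μ u v' := by
  funext n
  simp [ext₂, conv_add_right, sum_add_distrib]

lemma ext₂_shift_left (μ : ℕ → A →ₗ[k] B →ₗ[k] C) (u : ℕ → A) (v : ℕ → B) :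
    ext₂ μ (shift u) v = shift (ext₂ μ u v) := by
  funext n
  cases n with
  | zero => simp [ext₂, conv_shift_left, shift]
  | succ n => simp [ext₂, conv_shift_left, shift, Nat.sum_antidiagonal_succ']

lemma ext₂_shift_right (μ : ℕ → A →ₗ[k] B →ₗ[k] C) (u : ℕ → A) (v : ℕ → B) :
    ext₂ μ u (shift v) = shift (ext₂ μ u v) := by
  funext n
  cases n with
  | zero => simp [ext₂, conv_shift_right, shift]
  | succ n => simp [ext₂, conv_shift_right, shift, Nat.sum_antidiagonal_succ']

lemma ext₂_const_left (μ : ℕ → A →ₗ[k] B →ₗ[k] C) (x : A) (v : ℕ → B) (n : ℕ) :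
    ext₂ μ (const x) v n = ∑ p ∈ antidiagonal n, μ p.1 x (v p.2) := by
  simp [ext₂, conv_const_left]

lemma ext₂_const_right (μ : ℕ → A →ₗ[k] B →ₗ[k] C) (u : ℕ → A) (y : B) (n : ℕ) :
    ext₂ μ u (const y) n = ∑ p ∈ antidiagonal n, μ p.1 (u p.2) y := by
  simp [ext₂, conv_const_right]

lemma ext₂_const_const (μ : ℕ → A →ₗ[k] B →ₗ[k] C) (x : A) (y : B) (n : ℕ) :
    ext₂ μ (const x) (const y) n = μ n x y := by
  rw [ext₂_const_right]
  exact sum_antidiagonal_const (fun i x => μ i x y) (by simp) x n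

lemma sum_antidiagonal_fst_single (n : ℕ) (a : A) (f : ℕ → A → C) (hf : ∀ i, f i 0 = 0) :
    ∑ p ∈ antidiagonal n, f p.2 ((Pi.single n a : ℕ → A) p.1) = f 0 a := by
  rw [sum_eq_single (n, 0)]
  · simp
  · rintro ⟨i, j⟩ hp hne
    have hi : i ≠ n := by
      rintro rfl
      simp_all
    simp [hi, hf]
  · simp

/-- The failure of `φ` to intertwine the deformed operator `d` with `dA`. -/
def derDefect (φ d : ℕ → A →ₗ[k] A) (dA : A →ₗ[k] A) (u : ℕ → A) : ℕ → A :=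
  ext₁ φ (ext₁ d u) - fun n => dA (ext₁ φ u n)

lemma ext₁_ext₁ (φ d : ℕ → A →ₗ[k] A) (dA : A →ₗ[k] A) (u : ℕ → A) :
    ext₁ φ (ext₁ d u) = derDefect φ d dA u + fun n => dA (ext₁ φ u n) :=
  (sub_add_cancel _ _).symm

/-- The coefficient of order `n` of the intertwining defect on constants. -/
def derDefectCoeff (φ d : ℕ → A →ₗ[k] A) (dA : A →ₗ[k] A) (n : ℕ) : A →ₗ[k] A :=
  ∑ p ∈ antidiagonal n, φ p.1 ∘ₗ d p.2 - dA ∘ₗ φ n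

lemma derDefectCoeff_apply (φ d : ℕ → A →ₗ[k] A) (dA : A →ₗ[k] A) (n : ℕ) (x : A) :
    derDefectCoeff φ d dA n x = ∑ p ∈ antidiagonal n, φ p.1 (d p.2 x) - dA (φ n x) := by
  simp [derDefectCoeff, LinearMap.sum_apply]

lemma derDefect_const (φ d : ℕ → A →ₗ[k] A) (dA : A →ₗ[k] A) (n : ℕ) (x : A) :
    derDefect φ d dA (const x) n = derDefectCoeff φ d dA n x := by
  rw [derDefectCoeff_apply, derDefect, Pi.sub_apply, ext₁_const]
  rw [ext₁]
  simp only [ext₁_const]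

lemma derDefect_coeff {φ d : ℕ → A →ₗ[k] A} {dA : A →ₗ[k] A} {n : ℕ}
    (hd : ∀ m < n, derDefectCoeff φ d dA m = 0) (u : ℕ → A) :
    (∀ m < n, derDefect φ d dA u m = 0) ∧
      derDefect φ d dA u n = derDefectCoeff φ d dA n (u 0) := by
  have h := coeff_eq_of_coeff_const_eq_zero (T := derDefect φ d dA) (n := n)
    (fun u v => by
      funext m
      simp only [derDefect, ext₁_add, Pi.add_apply, Pi.sub_apply, map_add]; abel)
    (fun u => by simp only [derDefect, ext₁_shift, map_shift, shift_sub])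
    (fun m hm x => by simp [derDefect_const, hd m hm]) u
  exact ⟨h.1, by rw [h.2, derDefect_const]⟩

lemma derDefectCoeff_congr {φ φ' : ℕ → A →ₗ[k] A} {n : ℕ} (h : ∀ m ≤ n, φ m = φ' m)
    (d : ℕ → A →ₗ[k] A) (dA : A →ₗ[k] A) :
    derDefectCoeff φ d dA n = derDefectCoeff φ' d dA n := by
  unfold derDefectCoeff
  rw [h n le_rfl]
  congr 1
  exact sum_congr rfl fun p hp => by rw [h _ (Nat.le_of_lt_succ (Nat.antidiagonal.fst_lt hp))]

lemma derDefectCoeff_add_single (φ d : ℕ → A →ₗ[k] A) (dA : A →ₗ[k] A) (n : ℕ)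
    (ψ : A →ₗ[k] A) (x : A) :
    derDefectCoeff (φ + Pi.single n ψ) d dA n x =
      derDefectCoeff φ d dA n x + ψ (d 0 x) - dA (ψ x) := by
  have h : ∑ p ∈ antidiagonal n, (Pi.single n ψ : ℕ → A →ₗ[k] A) p.1 (d p.2 x) = ψ (d 0 x) :=
    sum_antidiagonal_fst_single n ψ (fun i f => f (d i x)) (by simp)
  simp only [derDefectCoeff_apply, Pi.add_apply, LinearMap.add_apply, sum_add_distrib, h,
    Pi.single_eq_same, map_add]
  abel

section Deformation

variable {R : Type*} [NonUnitalRing R] [Module k R] [SMulCommClass k R R] [IsScalarTower k R R]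

lemma conv_mul_assoc (u v w : ℕ → R) :
    conv (LinearMap.mul k R) (conv (LinearMap.mul k R) u v) w =
      conv (LinearMap.mul k R) u (conv (LinearMap.mul k R) v w) := by
  funext n
  simp only [conv, LinearMap.mul_apply', sum_mul, mul_sum, sum_sigma']
  apply sum_nbij' (fun ⟨⟨_, j⟩, ⟨a, b⟩⟩ => ⟨(a, b + j), (b, j)⟩)
    (fun ⟨⟨i, _⟩, ⟨a, b⟩⟩ => ⟨(i + a, b), (i, a)⟩) <;>
  · rintro ⟨⟨i, j⟩, ⟨a, b⟩⟩ h
    simp only [mem_sigma, HasAntidiagonal.mem_antidiagonal] at h ⊢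
    obtain ⟨rfl, h⟩ := h
    subst h
    simp [add_assoc, mul_assoc]

/-- A derivation of weight `lam` extends coefficientwise to a derivation of weight `lam` for the
Cauchy product. -/
lemma map_conv_mul {lam : k} {dA : R →ₗ[k] R}
    (hdA : ∀ x y : R, dA (x * y) = dA x * y + x * dA y + lam • (dA x * dA y))
    (u v : ℕ → R) (n : ℕ) :
    dA (conv (LinearMap.mul k R) u v n) =
      conv (LinearMap.mul k R) (fun i => dA (u i)) v n +
        conv (LinearMap.mul k R) u (fun i => dA (v i)) n +
        lam • conv (LinearMap.mul k R) (fun i => dA (u i)) (fun i => dA (v i)) n := by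
  simp [conv, hdA, sum_add_distrib, smul_sum]

/-- The failure of `φ` to be multiplicative from the deformed product `μ` to the Cauchy product. -/
def mulDefect (φ : ℕ → R →ₗ[k] R) (μ : ℕ → R →ₗ[k] R →ₗ[k] R) (u v : ℕ → R) : ℕ → R :=
  ext₁ φ (ext₂ μ u v) - conv (LinearMap.mul k R) (ext₁ φ u) (ext₁ φ v)

variable {φ d : ℕ → R →ₗ[k] R} {μ : ℕ → R →ₗ[k] R →ₗ[k] R} {dA : R →ₗ[k] R} {n : ℕ}

lemma ext₁_ext₂ (φ : ℕ → R →ₗ[k] R) (μ : ℕ → R →ₗ[k] R →ₗ[k] R) (u v : ℕ → R) :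
    ext₁ φ (ext₂ μ u v) =
      mulDefect φ μ u v + conv (LinearMap.mul k R) (ext₁ φ u) (ext₁ φ v) :=
  (sub_add_cancel _ _).symm

/-- The coefficient of order `n` of the multiplicativity defect on constants. -/
def mulDefectCoeff (φ : ℕ → R →ₗ[k] R) (μ : ℕ → R →ₗ[k] R →ₗ[k] R) (n : ℕ) :
    R →ₗ[k] R →ₗ[k] R :=
  ∑ p ∈ antidiagonal n, (μ p.2).compr₂ (φ p.1) -
    ∑ p ∈ antidiagonal n, (LinearMap.mul k R).compl₁₂ (φ p.1) (φ p.2)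

lemma mulDefectCoeff_apply (φ : ℕ → R →ₗ[k] R) (μ : ℕ → R →ₗ[k] R →ₗ[k] R) (n : ℕ) (x y : R) :
    mulDefectCoeff φ μ n x y =
      ∑ p ∈ antidiagonal n, φ p.1 (μ p.2 x y) - ∑ p ∈ antidiagonal n, φ p.1 x * φ p.2 y := by
  simp [mulDefectCoeff, LinearMap.sum_apply]

lemma mulDefect_const_const (φ : ℕ → R →ₗ[k] R) (μ : ℕ → R →ₗ[k] R →ₗ[k] R) (n : ℕ) (x y : R) :
    mulDefect φ μ (const x) (const y) n = mulDefectCoeff φ μ n x y := by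
  rw [mulDefectCoeff_apply, mulDefect, Pi.sub_apply]
  simp only [conv, LinearMap.mul_apply', ext₁_const]
  simp only [ext₁, ext₂_const_const]

lemma mulDefect_coeff (hμ : ∀ m < n, mulDefectCoeff φ μ m = 0) (u v : ℕ → R) :
    (∀ m < n, mulDefect φ μ u v m = 0) ∧
      mulDefect φ μ u v n = mulDefectCoeff φ μ n (u 0) (v 0) := by
  have hright (x : R) := coeff_eq_of_coeff_const_eq_zero (T := mulDefect φ μ (const x)) (n := n)
    (fun u v => by
      simp only [mulDefect, ext₂_add_right, ext₁_add, conv_add_right]; abel)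
    (fun u => by
      simp only [mulDefect, ext₂_shift_right, ext₁_shift, conv_shift_right, shift_sub])
    (fun m hm y => by simp [mulDefect_const_const, hμ m hm]) v
  have hleft := coeff_eq_of_coeff_const_eq_zero (T := fun u => mulDefect φ μ u v) (n := n)
    (fun u v => by
      simp only [mulDefect, ext₂_add_left, ext₁_add, conv_add_left]; abel)
    (fun u => by
      simp only [mulDefect, ext₂_shift_left, ext₁_shift, conv_shift_left, shift_sub])
    (fun m hm x => (hright x).1 m hm) u
  exact ⟨hleft.1, by rw [hleft.2, (hright _).2, mulDefect_const_const]⟩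

lemma mulDefectCoeff_cocycle (hφ : φ 0 = LinearMap.id) (hμ₀ : ∀ x y : R, μ 0 x y = x * y)
    (hassoc : ∀ x y z : R, ext₂ μ (ext₂ μ (const x) (const y)) (const z) =
      ext₂ μ (const x) (ext₂ μ (const y) (const z)))
    (hμ : ∀ m < n, mulDefectCoeff φ μ m = 0) (x y z : R) :
    x * mulDefectCoeff φ μ n y z - mulDefectCoeff φ μ n (x * y) z +
      mulDefectCoeff φ μ n x (y * z) - mulDefectCoeff φ μ n x y * z = 0 := by
  have h := congrFun (congrArg (ext₁ φ) (hassoc x y z)) n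
  simp only [ext₁_ext₂, conv_add_left, conv_add_right, conv_mul_assoc, Pi.add_apply] at h
  rw [conv_coeff_of_left_eq_zero _ _ (mulDefect_coeff hμ _ _).1,
    conv_coeff_of_right_eq_zero _ _ (mulDefect_coeff hμ _ _).1] at h
  simp only [(mulDefect_coeff hμ _ _).2, ext₁_const, ext₂_const_const, hφ, hμ₀,
    LinearMap.mul_apply', LinearMap.id_apply] at h
  simp only [const, Pi.single_eq_same] at h
  rw [← add_assoc, ← add_assoc, add_left_inj] at h
  linear_combination (norm := module) -h

lemma derDefectCoeff_cocycle {lam : k} (hn : n ≠ 0)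
    (hdA : ∀ x y : R, dA (x * y) = dA x * y + x * dA y + lam • (dA x * dA y))
    (hφ : φ 0 = LinearMap.id) (hμ₀ : ∀ x y : R, μ 0 x y = x * y) (hd₀ : d 0 = dA)
    (hder : ∀ x y : R, ext₁ d (ext₂ μ (const x) (const y)) =
      ext₂ μ (ext₁ d (const x)) (const y) + ext₂ μ (const x) (ext₁ d (const y)) +
        lam • ext₂ μ (ext₁ d (const x)) (ext₁ d (const y)))
    (hμ : ∀ m < n, mulDefectCoeff φ μ m = 0) (hd : ∀ m < n, derDefectCoeff φ d dA m = 0)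
    (x y : R) :
    ((x + lam • dA x) * derDefectCoeff φ d dA n y - derDefectCoeff φ d dA n (x * y) +
        derDefectCoeff φ d dA n x * (y + lam • dA y)) +
      (mulDefectCoeff φ μ n (dA x) y + mulDefectCoeff φ μ n x (dA y) +
        lam • mulDefectCoeff φ μ n (dA x) (dA y) - dA (mulDefectCoeff φ μ n x y)) = 0 := by
  have h := congrFun (congrArg (ext₁ φ) (hder x y)) n
  have hD₀ (u : ℕ → R) : derDefect φ d dA u 0 = 0 :=
    (derDefect_coeff hd u).1 0 (Nat.pos_of_ne_zero hn)
  simp only [ext₁_add, ext₁_smul, ext₁_ext₁ φ d dA, ext₁_ext₂ φ μ, conv_add_left, conv_add_right,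
    Pi.add_apply, Pi.smul_apply, map_add, map_conv_mul hdA] at h
  simp only [conv_coeff_of_left_eq_zero _ _ (derDefect_coeff hd _).1,
    conv_coeff_of_right_eq_zero _ _ (derDefect_coeff hd _).1] at h
  simp only [(mulDefect_coeff hμ _ _).2, (derDefect_coeff hd _).2, hD₀, ext₁_const,
    ext₂_const_const, hφ, hμ₀, hd₀, LinearMap.mul_apply', LinearMap.id_apply] at h
  simp only [const, Pi.single_eq_same, mul_zero, zero_add, smul_add] at h
  simp only [add_mul, mul_add, smul_mul_assoc, mul_smul_comm]
  linear_combination (norm := module) -h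

lemma mulDefectCoeff_congr {φ' : ℕ → R →ₗ[k] R} (h : ∀ m ≤ n, φ m = φ' m)
    (μ : ℕ → R →ₗ[k] R →ₗ[k] R) : mulDefectCoeff φ μ n = mulDefectCoeff φ' μ n := by
  unfold mulDefectCoeff
  congr 1 <;> refine sum_congr rfl fun p hp => ?_
  · rw [h _ (Nat.le_of_lt_succ (Nat.antidiagonal.fst_lt hp))]
  · rw [h _ (Nat.le_of_lt_succ (Nat.antidiagonal.fst_lt hp)),
      h _ (Nat.le_of_lt_succ (Nat.antidiagonal.snd_lt hp))]

lemma mulDefectCoeff_add_single (hn : n ≠ 0) (hφ : φ 0 = LinearMap.id)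
    (hμ₀ : ∀ x y : R, μ 0 x y = x * y) (ψ : R →ₗ[k] R) (x y : R) :
    mulDefectCoeff (φ + Pi.single n ψ) μ n x y =
      mulDefectCoeff φ μ n x y + ψ (x * y) - x * ψ y - ψ x * y := by
  let σ : ℕ → R →ₗ[k] R := Pi.single n ψ
  have hσ₀ : σ 0 = 0 := Pi.single_eq_of_ne hn.symm _
  have hσ : σ n = ψ := Pi.single_eq_same _ _
  have hlow (z : R) : ∀ m < n, σ m z = 0 := fun m hm => by simp [σ, hm.ne]
  have hμσ : ∑ p ∈ antidiagonal n, σ p.1 (μ p.2 x y) = ψ (μ 0 x y) :=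
    sum_antidiagonal_fst_single n ψ (fun i f => f (μ i x y)) (by simp)
  have hl (τ : ℕ → R →ₗ[k] R) : ∑ p ∈ antidiagonal n, σ p.1 x * τ p.2 y = ψ x * τ 0 y := by
    simpa [conv, hσ] using
      conv_coeff_of_left_eq_zero (LinearMap.mul k R) (fun i => τ i y) (hlow x)
  have hr : ∑ p ∈ antidiagonal n, φ p.1 x * σ p.2 y = φ 0 x * ψ y := by
    simpa [conv, hσ] using
      conv_coeff_of_right_eq_zero (LinearMap.mul k R) (fun i => φ i x) (hlow y)
  change mulDefectCoeff (φ + σ) μ n x y = _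
  simp only [mulDefectCoeff_apply, Pi.add_apply, LinearMap.add_apply, add_mul, mul_add,
    sum_add_distrib, hμσ, hl, hr, hσ₀, hφ, hμ₀, LinearMap.zero_apply, mul_zero, add_zero,
    LinearMap.id_apply]
  abel

end Deformation

end FormalSeries

open FormalSeries

theorem vanishing_second_cohomology_implies_rigidity
    {k : Type*} [Field k] [CharZero k] (lam : k)
    {A : Type*} [NonUnitalRing A] [Module k A] [SMulCommClass k A A] [IsScalarTower k A A]
    (dA : A →ₗ[k] A)
    (hdA : ∀ x y : A, dA (x * y) = dA x * y + x * dA y + lam • (dA x * dA y))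
    -- H̃²_Diff(A, A) = 0: every 2-cocycle (f, g) is a coboundary ∂_Diff(φ)
    (hH2 : ∀ (f : A →ₗ[k] A →ₗ[k] A) (g : A →ₗ[k] A),
      (∀ x y z : A, x * f y z - f (x * y) z + f x (y * z) - f x y * z = 0) →
      (∀ x y : A,
        ((x + lam • dA x) * g y - g (x * y) + g x * (y + lam • dA y))
          + (f (dA x) y + f x (dA y) + lam • f (dA x) (dA y) - dA (f x y)) = 0) →
      ∃ φ : A →ₗ[k] A,
        (∀ x y : A, f x y = x * φ y - φ (x * y) + φ x * y) ∧
        (∀ x : A, g x = dA (φ x) - φ (dA x))) :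
    -- then (A, dA) is rigid: every 1-parameter formal deformation (μ_t, d_t)
    -- is equivalent to the trivial deformation (μ_A, dA)
    ∀ (μ : ℕ → A →ₗ[k] A →ₗ[k] A) (d : ℕ → A →ₗ[k] A),
      (∀ x y : A, μ 0 x y = x * y) →
      d 0 = dA →
      (∀ (n : ℕ) (x y z : A),
        ∑ i ∈ range (n + 1), μ i (μ (n - i) x y) z
          = ∑ i ∈ range (n + 1), μ i x (μ (n - i) y z)) →
      (∀ (n : ℕ) (x y : A),
        ∑ p ∈ antidiagonal n, d p.2 (μ p.1 x y)
          = ∑ p ∈ antidiagonal n, (μ p.1 (d p.2 x) y + μ p.1 x (d p.2 y))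
            + lam • ∑ p ∈ antidiagonal n, ∑ q ∈ antidiagonal p.2,
                μ p.1 (d q.1 x) (d q.2 y)) →
      -- there is a formal isomorphism Φ_t = Σ φᵢ tⁱ with φ₀ = id from (μ_t, d_t)
      -- to the trivial deformation:  Φ_t ∘ μ_t = μ_A ∘ (Φ_t × Φ_t), Φ_t ∘ d_t = dA ∘ Φ_t
      ∃ φ : ℕ → A →ₗ[k] A,
        φ 0 = LinearMap.id ∧
        (∀ (n : ℕ) (x y : A),
          ∑ p ∈ antidiagonal n, φ p.1 (μ p.2 x y)
            = ∑ p ∈ antidiagonal n, φ p.1 x * φ p.2 y) ∧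
        (∀ (n : ℕ) (x : A),
          ∑ p ∈ antidiagonal n, φ p.1 (d p.2 x) = dA (φ n x)) := by
  intro μ d hμ₀ hd₀ hassoc hder
  have hassoc' (x y z : A) : ext₂ μ (ext₂ μ (const x) (const y)) (const z) =
      ext₂ μ (const x) (ext₂ μ (const y) (const z)) := by
    funext n
    rw [ext₂_const_right, ext₂_const_left]
    simp only [ext₂_const_const]
    rw [Nat.sum_antidiagonal_eq_sum_range_succ (fun i j => μ i (μ j x y) z),
      Nat.sum_antidiagonal_eq_sum_range_succ (fun i j => μ i x (μ j y z))]
    exact hassoc n x y z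
  have hder' (x y : A) : ext₁ d (ext₂ μ (const x) (const y)) =
      ext₂ μ (ext₁ d (const x)) (const y) + ext₂ μ (const x) (ext₁ d (const y)) +
        lam • ext₂ μ (ext₁ d (const x)) (ext₁ d (const y)) := by
    funext n
    rw [Pi.add_apply, Pi.add_apply, Pi.smul_apply, ext₂_const_right, ext₂_const_left, ext₁,
      ← Nat.sum_antidiagonal_swap]
    simp only [ext₂_const_const, ext₁_const, ← sum_add_distrib]
    simp only [ext₂, conv, ext₁_const]
    exact hder n x y
  let P (n : ℕ) (φ : ℕ → A →ₗ[k] A) : Prop := φ 0 = LinearMap.id ∧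
    ∀ m < n, mulDefectCoeff φ μ m = 0 ∧ derDefectCoeff φ d dA m = 0
  have hstep (n : ℕ) (φ : {φ // P (n + 1) φ}) :
      ∃ φ' : {φ // P (n + 2) φ}, ∀ m ≤ n, φ'.1 m = φ.1 m := by
    obtain ⟨φ, hφ₀, hφ⟩ := φ
    obtain ⟨ψ, hψμ, hψd⟩ := hH2 (mulDefectCoeff φ μ (n + 1)) (derDefectCoeff φ d dA (n + 1))
      (mulDefectCoeff_cocycle hφ₀ hμ₀ hassoc' fun m hm => (hφ m hm).1)
      (derDefectCoeff_cocycle n.succ_ne_zero hdA hφ₀ hμ₀ hd₀ hder' (fun m hm => (hφ m hm).1)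
        fun m hm => (hφ m hm).2)
    have hagree : ∀ m ≤ n, (φ + Pi.single (n + 1) ψ : ℕ → A →ₗ[k] A) m = φ m := fun m hm => by
      simp [show m ≠ n + 1 by omega]
    refine ⟨⟨φ + Pi.single (n + 1) ψ, by rw [hagree 0 n.zero_le, hφ₀], fun m hm => ?_⟩, hagree⟩
    rcases Nat.lt_succ_iff_lt_or_eq.mp hm with hm | rfl
    · have hle : ∀ i ≤ m, (φ + Pi.single (n + 1) ψ : ℕ → A →ₗ[k] A) i = φ i :=
        fun i hi => hagree i (by omega)
      rw [mulDefectCoeff_congr hle, derDefectCoeff_congr hle]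
      exact hφ m hm
    · constructor
      · ext x y
        rw [mulDefectCoeff_add_single n.succ_ne_zero hφ₀ hμ₀, hψμ, LinearMap.zero_apply,
          LinearMap.zero_apply]
        abel
      · ext x
        rw [derDefectCoeff_add_single, hψd, hd₀, LinearMap.zero_apply]
        abel
  choose next hnext using hstep
  have hinit : P 1 (Pi.single 0 LinearMap.id) := by
    refine ⟨Pi.single_eq_same _ _, fun m hm => ?_⟩
    obtain rfl : m = 0 := by omega
    constructor
    · ext x y
      simp [mulDefectCoeff_apply, hμ₀]
    · ext x
      simp [derDefectCoeff_apply, hd₀]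
  let Φ (n : ℕ) : {φ // P (n + 1) φ} := Nat.rec ⟨_, hinit⟩ next n
  have hΦ (m n : ℕ) (hmn : m ≤ n) : (Φ m).1 m = (Φ n).1 m := by
    induction n, hmn using Nat.le_induction with
    | base => rfl
    | succ n hmn ih => exact ih.trans (hnext n (Φ n) m hmn).symm
  have hcoeff (n : ℕ) := (Φ n).2.2 n n.lt_succ_self
  refine ⟨fun n => (Φ n).1 n, (Φ 0).2.1, fun n x y => ?_, fun n x => ?_⟩
  · rw [← sub_eq_zero, ← mulDefectCoeff_apply (fun n => (Φ n).1 n),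
      mulDefectCoeff_congr (fun m hm => hΦ m n hm), (hcoeff n).1]
    rfl
  · rw [← sub_eq_zero, ← derDefectCoeff_apply (fun n => (Φ n).1 n),
      derDefectCoeff_congr (fun m hm => hΦ m n hm), (hcoeff n).2]
    rfl
end
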